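/- Suppose R is not simply laced and let λ be a long root. Then D_λ(ℓ) = 0 if λ is a positive root and D_λ(ℓ) = 1 if λ is a negative root. -/

import Mathlib

open scoped RealInnerProductSpace

attribute [local instance] Classical.propDecidable

noncomputable section

/-- The reflection in the hyperplane orthogonal to `α`. -/
def sref {V : Type*} [NormedAddCommGroup V] [InnerProductSpace ℝ V] (α x : V) : V :=
  x - (2 * ⟪x, α⟫ / ⟪α, α⟫) • α

/-- The coroot `α^∨ = 2α/(α,α)`. -/
def coroot {V : Type*} [NormedAddCommGroup V] [InnerProductSpace ℝ V] (α : V) : V :=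
  (2 / ⟪α, α⟫) • α

/-- The data of a finite reduced irreducible crystallographic root system `R` in a real
inner product space, together with a fixed choice of positive roots and simple roots. -/
structure RSD (V : Type*) [NormedAddCommGroup V] [InnerProductSpace ℝ V] where
  R : Finset V
  Rpos : Finset V
  n : ℕ
  npos : 0 < n
  simple : Fin n → V
  simple_mem : ∀ i, simple i ∈ Rpos
  pos_sub : Rpos ⊆ R
  root_ne_zero : ∀ α ∈ R, α ≠ 0
  pos_or_neg : ∀ α ∈ R, α ∈ Rpos ∨ -α ∈ Rpos
  not_both : ∀ α ∈ Rpos, -α ∉ Rpos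
  pos_combo : ∀ α ∈ Rpos, ∃ c : Fin n → ℕ, α = ∑ i, (c i : ℝ) • simple i
  simple_indep : LinearIndependent ℝ simple
  reduced : ∀ α ∈ R, ∀ c : ℝ, c • α ∈ R → c = 1 ∨ c = -1
  crystal : ∀ α ∈ R, ∀ β ∈ R, ∃ k : ℤ, ⟪β, coroot α⟫ = (k : ℝ)
  refl_mem : ∀ α ∈ R, ∀ β ∈ R, sref α β ∈ R
  spanning : Submodule.span ℝ (R : Set V) = ⊤
  irred : ∀ s : Set V, (∀ α ∈ R, ∀ β ∈ R, α ∈ s → β ∉ s → ⟪α, β⟫ = 0) →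
    (∀ α ∈ R, α ∈ s) ∨ (∀ α ∈ R, α ∉ s)

namespace RSD

variable {V : Type*} [NormedAddCommGroup V] [InnerProductSpace ℝ V]

/-- The map of `V` determined by a word in the simple reflections. -/
def wordMap (S : RSD V) (l : List (Fin S.n)) : V → V :=
  l.foldr (fun i f => sref (S.simple i) ∘ f) id

/-- `w : V → V` is an element of the Weyl group `W`, i.e. a product of simple reflections. -/
def IsWeyl (S : RSD V) (w : V → V) : Prop := ∃ l : List (Fin S.n), w = S.wordMap l

/-- The length `ℓ(w)` of a Weyl group element: the smallest length of a word in the simple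
reflections representing `w`. -/
def len (S : RSD V) (w : V → V) : ℕ :=
  sInf {k | ∃ l : List (Fin S.n), l.length = k ∧ w = S.wordMap l}

/-- `x` and `y` lie in the same Weyl group orbit. -/
def sameOrbit (S : RSD V) (x y : V) : Prop := ∃ w, S.IsWeyl w ∧ w x = y

/-- `x` is dominant: `(x, α_i) ≥ 0` for all simple roots. -/
def Dominant (S : RSD V) (x : V) : Prop := ∀ i, 0 ≤ ⟪x, S.simple i⟫

/-- `w` is a Weyl group element of minimal length among those sending `x` to `y`. -/
def IsMinWord (S : RSD V) (x y : V) (w : V → V) : Prop :=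
  S.IsWeyl w ∧ w x = y ∧ ∀ w' : V → V, S.IsWeyl w' → w' x = y → S.len w ≤ S.len w'

/-- Membership in the root lattice `Q`, the ℤ-span of the simple roots. -/
def inQ (S : RSD V) (x : V) : Prop :=
  ∃ c : Fin S.n → ℤ, x = ∑ i, (c i : ℝ) • S.simple i

/-- The height `ht(λ) = Σ a_i` of an element `λ = Σ a_i α_i` of the root lattice
(the coefficients are unique since the simple roots are linearly independent). -/
def htZ (S : RSD V) (x : V) : ℤ :=
  if h : ∃ c : Fin S.n → ℤ, x = ∑ i, (c i : ℝ) • S.simple i then ∑ i, h.choose i else 0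

/-- The inversion set `Π(w) = {α ∈ R⁺ : w(α) ∈ R⁻}`. -/
def PiSet (S : RSD V) (w : V → V) : Finset V :=
  S.Rpos.filter (fun α => -(w α) ∈ S.Rpos)

/-- `α` is a short root (if all roots have the same length, all roots are short). -/
def IsShort (S : RSD V) (α : V) : Prop :=
  α ∈ S.R ∧ ∀ β ∈ S.R, ⟪α, α⟫ ≤ ⟪β, β⟫

/-- `α` is a long root. -/
def IsLong (S : RSD V) (α : V) : Prop :=
  α ∈ S.R ∧ ∀ β ∈ S.R, ⟪β, β⟫ ≤ ⟪α, α⟫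

/-- The short roots in the inversion set `Π(w)`. -/
def PiS (S : RSD V) (w : V → V) : Finset V :=
  (S.PiSet w).filter (fun α => S.IsShort α)

/-- The long roots in the inversion set `Π(w)`. -/
def PiL (S : RSD V) (w : V → V) : Finset V :=
  (S.PiSet w).filter (fun α => S.IsLong α)

end RSD


section Reflection

variable {V : Type*} [NormedAddCommGroup V] [InnerProductSpace ℝ V]

theorem inner_sref_sref (a x y : V) : ⟪sref a x, sref a y⟫ = ⟪x, y⟫ := by
  rcases eq_or_ne a 0 with rfl | ha
  · simp [sref]
  · have h : ⟪a, a⟫ ≠ 0 := inner_self_ne_zero.mpr ha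
    simp only [sref, inner_sub_left, inner_sub_right, real_inner_smul_left,
      real_inner_smul_right, real_inner_comm a y]
    field_simp
    ring

theorem sref_sub_smul (a x y : V) (c : ℝ) :
    sref a (x - c • y) = sref a x - c • sref a y := by
  simp only [sref, inner_sub_left, real_inner_smul_left]
  module

theorem sref_sref_comm (a b x : V) : sref a (sref b x) = sref (sref a b) (sref a x) := by
  conv_lhs => rw [sref.eq_def b x, sref_sub_smul]
  rw [sref.eq_def (sref a b), inner_sref_sref, inner_sref_sref]

theorem sref_self {a : V} (ha : a ≠ 0) : sref a a = -a := by
  have h : ⟪a, a⟫ ≠ 0 := inner_self_ne_zero.mpr ha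
  rw [sref, mul_div_assoc, div_self h]
  module

theorem sref_sref {a : V} (ha : a ≠ 0) (x : V) : sref a (sref a x) = x := by
  rw [sref.eq_def a x, sref_sub_smul, sref_self ha, sref]
  module

theorem sref_of_inner_eq_zero {a x : V} (h : ⟪x, a⟫ = 0) : sref a x = x := by
  simp [sref, h]

end Reflection

namespace RSD

variable {V : Type*} [NormedAddCommGroup V] [InnerProductSpace ℝ V] (S : RSD V)

theorem wordMap_cons (i : Fin S.n) (l : List (Fin S.n)) (x : V) :
    S.wordMap (i :: l) x = sref (S.simple i) (S.wordMap l x) := rfl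

theorem inner_wordMap (l : List (Fin S.n)) (x y : V) :
    ⟪S.wordMap l x, S.wordMap l y⟫ = ⟪x, y⟫ := by
  induction l with
  | nil => rfl
  | cons i l ih => rw [wordMap_cons, wordMap_cons, inner_sref_sref, ih]

theorem wordMap_sref (l : List (Fin S.n)) (a x : V) :
    S.wordMap l (sref a x) = sref (S.wordMap l a) (S.wordMap l x) := by
  induction l with
  | nil => rfl
  | cons i l ih => rw [wordMap_cons, wordMap_cons, wordMap_cons, ih, sref_sref_comm]

theorem wordMap_mem {x : V} (hx : x ∈ S.R) (l : List (Fin S.n)) : S.wordMap l x ∈ S.R := by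
  induction l with
  | nil => exact hx
  | cons i l ih => exact S.refl_mem _ (S.pos_sub (S.simple_mem i)) _ ih

theorem simple_ne_zero (i : Fin S.n) : S.simple i ≠ 0 :=
  S.root_ne_zero _ (S.pos_sub (S.simple_mem i))

/-- The only positive root sent to a negative root by a simple reflection is its simple root. -/
theorem eq_simple_of_neg_sref_mem {i : Fin S.n} {β : V} (hβ : β ∈ S.Rpos)
    (h : -sref (S.simple i) β ∈ S.Rpos) : β = S.simple i := by
  obtain ⟨c, hc⟩ := S.pos_combo _ hβ
  obtain ⟨d, hd⟩ := S.pos_combo _ h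
  obtain ⟨m, hm⟩ : ∃ m : ℝ, β + -sref (S.simple i) β = m • S.simple i :=
    ⟨_, by rw [sref]; abel⟩
  have hsum : ∑ j, ((c j : ℝ) + d j - if j = i then m else 0) • S.simple j = 0 := by
    simp only [sub_smul, add_smul, Finset.sum_sub_distrib, Finset.sum_add_distrib, ← hc, ← hd,
      hm, ite_smul, zero_smul, Finset.sum_ite_eq', Finset.mem_univ, if_true, sub_self]
  have hzero := Fintype.linearIndependent_iff.mp S.simple_indep _ hsum
  have hcj : ∀ j, j ≠ i → (c j : ℝ) = 0 := by
    intro j hj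
    have hj0 := hzero j
    rw [if_neg hj, sub_zero] at hj0
    have h1 : (0 : ℝ) ≤ c j := Nat.cast_nonneg _
    have h2 : (0 : ℝ) ≤ d j := Nat.cast_nonneg _
    linarith
  have hβi : β = (c i : ℝ) • S.simple i := by
    rw [hc]
    exact Finset.sum_eq_single i (fun j _ hj => by rw [hcj j hj, zero_smul])
      (fun hi => absurd (Finset.mem_univ i) hi)
  rcases S.reduced _ (S.pos_sub (S.simple_mem i)) (c i) (hβi ▸ S.pos_sub hβ) with h1 | h1
  · rw [hβi, h1, one_smul]
  · have h2 : (0 : ℝ) ≤ c i := Nat.cast_nonneg _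
    linarith

/-- The strong exchange condition. -/
theorem exists_wordMap_comp_sref (l : List (Fin S.n)) {α : V} (hα : α ∈ S.Rpos)
    (h : -S.wordMap l α ∈ S.Rpos) :
    ∃ l' : List (Fin S.n), l'.length + 1 = l.length ∧
      S.wordMap l' = S.wordMap l ∘ sref α := by
  induction l with
  | nil => exact absurd h (S.not_both _ hα)
  | cons i l ih =>
    by_cases hl : -S.wordMap l α ∈ S.Rpos
    · obtain ⟨l', hlen, hl'⟩ := ih hl
      refine ⟨i :: l', by simp [hlen], funext fun x => ?_⟩
      rw [wordMap_cons, hl', Function.comp_apply, Function.comp_apply, wordMap_cons]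
    · have hpos := (S.pos_or_neg _ (S.wordMap_mem (S.pos_sub hα) l)).resolve_right hl
      have hi := S.eq_simple_of_neg_sref_mem hpos h
      refine ⟨l, rfl, funext fun x => ?_⟩
      rw [Function.comp_apply, wordMap_cons, wordMap_sref, hi, sref_sref (S.simple_ne_zero i)]

theorem len_wordMap_le (l : List (Fin S.n)) : S.len (S.wordMap l) ≤ l.length :=
  Nat.sInf_le ⟨l, rfl, rfl⟩

theorem exists_length_eq_len {w : V → V} (hw : S.IsWeyl w) :
    ∃ l : List (Fin S.n), l.length = S.len w ∧ w = S.wordMap l := by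
  obtain ⟨l, hl⟩ := hw
  exact Nat.sInf_mem (s := {k | ∃ l : List (Fin S.n), l.length = k ∧ w = S.wordMap l})
    ⟨_, l, rfl, hl⟩

/-- Inversions of a shortest element sending `x` to `y` are not orthogonal to `x`. -/
theorem inner_ne_zero_of_mem_PiSet {x y : V} {w : V → V} (hw : S.IsMinWord x y w) {α : V}
    (hα : α ∈ S.PiSet w) : ⟪x, α⟫ ≠ 0 := by
  intro h0
  obtain ⟨hW, hxy, hmin⟩ := hw
  obtain ⟨hpos, hneg⟩ := Finset.mem_filter.mp hα
  obtain ⟨l, hlen, rfl⟩ := S.exists_length_eq_len hW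
  obtain ⟨l', hlen', hl'⟩ := S.exists_wordMap_comp_sref l hpos hneg
  have hle := hmin (S.wordMap l') ⟨l', rfl⟩
    (by rw [hl', Function.comp_apply, sref_of_inner_eq_zero h0, hxy])
  have hle' := S.len_wordMap_le l'
  omega

theorem Dominant.inner_nonneg {S : RSD V} {x : V} (hx : S.Dominant x) {α : V}
    (hα : α ∈ S.Rpos) : 0 ≤ ⟪x, α⟫ := by
  obtain ⟨c, rfl⟩ := S.pos_combo _ hα
  simp only [inner_sum, real_inner_smul_right]
  exact Finset.sum_nonneg fun i _ => mul_nonneg (Nat.cast_nonneg _) (hx i)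

theorem Dominant.mem_Rpos {S : RSD V} {x : V} (hx : S.Dominant x) (hR : x ∈ S.R) :
    x ∈ S.Rpos := by
  refine (S.pos_or_neg x hR).resolve_right fun hneg => ?_
  have h := hx.inner_nonneg hneg
  rw [inner_neg_right] at h
  have := real_inner_self_pos.mpr (S.root_ne_zero x hR)
  linarith

theorem IsLong.of_sameOrbit {S : RSD V} {x y : V} (hx : S.IsLong x) (h : S.sameOrbit x y) :
    S.IsLong y := by
  obtain ⟨_, ⟨l, rfl⟩, rfl⟩ := h
  exact ⟨S.wordMap_mem hx.1 l, fun β hβ => by rw [inner_wordMap]; exact hx.2 β hβ⟩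

theorem IsLong.inner_coroot_eq_one {S : RSD V} {α β : V} (hα : S.IsLong α) (hβ : S.IsLong β)
    (hne : β ≠ α) (hpos : 0 < ⟪β, α⟫) : ⟪β, coroot α⟫ = 1 := by
  obtain ⟨k, hk⟩ := S.crystal α hα.1 β hβ.1
  have hlen : ⟪β, β⟫ = ⟪α, α⟫ := le_antisymm (hα.2 β hβ.1) (hβ.2 α hα.1)
  have hα0 := real_inner_self_pos.mpr (S.root_ne_zero α hα.1)
  have hsub := real_inner_self_pos.mpr (sub_ne_zero.mpr hne)
  rw [real_inner_sub_sub_self, hlen] at hsub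
  have hval : (k : ℝ) * ⟪α, α⟫ = 2 * ⟪β, α⟫ := by
    rw [← hk, coroot, real_inner_smul_right]
    field_simp
  have h0 : (0 : ℝ) < k := by
    by_contra! h
    nlinarith
  have h2 : (k : ℝ) < 2 := by
    by_contra! h
    nlinarith
  have h0' : 0 < k := by exact_mod_cast h0
  have h2' : k < 2 := by exact_mod_cast h2
  obtain rfl : k = 1 := by omega
  simpa using hk

theorem inner_coroot_self {α : V} (hα : α ≠ 0) : ⟪α, coroot α⟫ = 2 := by
  rw [coroot, real_inner_smul_right, div_mul_cancel₀ _ (inner_self_ne_zero.mpr hα)]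

end RSD

/-- Suppose `R` is not simply laced and `λ` is a long root. Then
`D_λ(ℓ) = Σ_{α ∈ Π_ℓ(w_λ)} ((λ₊, α^∨) − 1)` equals `0` if `λ` is a positive root and `1` if
`λ` is a negative root. -/
theorem Dl_of_long_root
    {V : Type*} [NormedAddCommGroup V] [InnerProductSpace ℝ V]
    (S : RSD V) (hTwo : ∃ α ∈ S.R, ∃ β ∈ S.R, ⟪α, α⟫ ≠ ⟪β, β⟫)
    (lam : V) (hlong : S.IsLong lam)
    (lamp : V) (hdom : S.Dominant lamp) (horb : S.sameOrbit lam lamp)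
    (w : V → V) (hw : S.IsMinWord lamp lam w) :
    (lam ∈ S.Rpos → ∑ α ∈ S.PiL w, (⟪lamp, coroot α⟫ - 1) = 0) ∧
      (-lam ∈ S.Rpos → ∑ α ∈ S.PiL w, (⟪lamp, coroot α⟫ - 1) = 1) := by
  have hlp : S.IsLong lamp := hlong.of_sameOrbit horb
  have hterm : ∀ α ∈ S.PiL w, α ≠ lamp → ⟪lamp, coroot α⟫ - 1 = 0 := by
    intro α hα hne
    obtain ⟨hPi, hαl⟩ := Finset.mem_filter.mp hα
    have hpos := (hdom.inner_nonneg (Finset.mem_filter.mp hPi).1).lt_of_ne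
      (S.inner_ne_zero_of_mem_PiSet hw hPi).symm
    rw [hαl.inner_coroot_eq_one hlp hne.symm hpos, sub_self]
  have hmem : lamp ∈ S.PiL w ↔ -lam ∈ S.Rpos := by
    simp [RSD.PiL, RSD.PiSet, hlp, hdom.mem_Rpos hlp.1, hw.2.1]
  constructor
  · intro hlam
    refine Finset.sum_eq_zero fun α hα => hterm α hα ?_
    rintro rfl
    exact S.not_both _ hlam (hmem.mp hα)
  · intro hlam
    rw [Finset.sum_eq_single lamp hterm fun h => absurd (hmem.mpr hlam) h,
      RSD.inner_coroot_self (S.root_ne_zero _ hlp.1)]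
    norm_num

end
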